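/- In the Euclidean plane ℝ², let φ and θ be real numbers with |θ| ≤ π/4, let e^s = (cos φ, sin φ) be a unit vector, let e^s_⊥ = (−sin φ, cos φ) be its rotation by π/2, and let e^u = cos θ · e^s + sin θ · e^s_⊥. Then for all real numbers v_u and v_s, writing v = v_u · e^u + v_s · e^s and |v| := max(|v_u|, |v_s|), one has (√3/2) · |θ| · |v| ≤ ‖v‖ ≤ 2 · |v|, where ‖·‖ is the Euclidean norm. (This is the norm-comparison lemma of the paper, with the explicit lower-bound constant obtained from |sin θ| ≥ (√3/2)|θ| in place of χ₁·l(M).) -/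

import Mathlib

/-- On `[0, π / 4]` the concave function `sin` lies above the chord through `0` and `π / 4`,
whose slope exceeds `√3 / 2`. -/
lemma sqrt_three_div_two_mul_le_sin {x : ℝ} (hx₀ : 0 ≤ x) (hx : x ≤ Real.pi / 4) :
    Real.sqrt 3 / 2 * x ≤ Real.sin x := by
  have hpi := Real.pi_pos
  have hslope : Real.sqrt 3 * Real.pi ≤ 4 * Real.sqrt 2 := by
    refine abs_le_of_sq_le_sq' ?_ (by positivity) |>.2
    rw [mul_pow, mul_pow, Real.sq_sqrt (by norm_num), Real.sq_sqrt (by norm_num)]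
    nlinarith [Real.pi_lt_d2]
  have hchord : 4 * x / Real.pi * (Real.sqrt 2 / 2) ≤ Real.sin x := by
    have hle : 4 * x / Real.pi ≤ 1 := by
      rw [div_le_one hpi]
      linarith
    have h := strictConcaveOn_sin_Icc.concaveOn.2
      (x := 0) (y := Real.pi / 4) ⟨le_rfl, hpi.le⟩ ⟨by positivity, by linarith⟩
      (sub_nonneg.2 hle) (by positivity : 0 ≤ 4 * x / Real.pi) (by ring)
    have hx' : 4 * x / Real.pi * (Real.pi / 4) = x := by
      field_simp
    simpa [hx'] using h
  refine le_trans ?_ hchord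
  rw [div_mul_div_comm, div_mul_eq_mul_div, div_le_div_iff₀ two_pos (by positivity)]
  nlinarith [mul_le_mul_of_nonneg_right hslope hx₀]

lemma sqrt_three_div_two_mul_abs_le_abs_sin {x : ℝ} (hx : |x| ≤ Real.pi / 4) :
    Real.sqrt 3 / 2 * |x| ≤ |Real.sin x| := by
  rw [Real.abs_sin_eq_sin_abs_of_abs_le_pi (by linarith [Real.pi_pos])]
  exact sqrt_three_div_two_mul_le_sin (abs_nonneg x) hx

open Real in
theorem norm_comparison_plane (φ θ : ℝ) (hθ : |θ| ≤ π / 4)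
    (es esPerp eu : EuclideanSpace ℝ (Fin 2))
    (hes : es = (WithLp.equiv 2 (Fin 2 → ℝ)).symm ![cos φ, sin φ])
    (hesPerp : esPerp = (WithLp.equiv 2 (Fin 2 → ℝ)).symm ![-sin φ, cos φ])
    (heu : eu = cos θ • es + sin θ • esPerp)
    (vu vs : ℝ) :
    (Real.sqrt 3 / 2) * |θ| * max |vu| |vs| ≤ ‖vu • eu + vs • es‖ ∧
      ‖vu • eu + vs • es‖ ≤ 2 * max |vu| |vs| := by
  have hφ := sin_sq_add_cos_sq φ
  have hθ' := sin_sq_add_cos_sq θ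
  have hes_norm : ‖es‖ = 1 := by
    simp [hes, EuclideanSpace.norm_eq, Fin.sum_univ_two]
  have hnorm : ‖vu • eu + vs • es‖ ^ 2 = (vu * cos θ + vs) ^ 2 + (vu * sin θ) ^ 2 := by
    simp only [heu, hes, hesPerp, EuclideanSpace.norm_sq_eq, Fin.sum_univ_two, norm_eq_abs, sq_abs]
    simp
    linear_combination ((vu * cos θ + vs) ^ 2 + (vu * sin θ) ^ 2) * hφ
  have heu_norm : ‖eu‖ = 1 := by
    rw [← sq_eq_sq₀ (norm_nonneg _) zero_le_one]
    simp only [heu, hes, hesPerp, EuclideanSpace.norm_sq_eq, Fin.sum_univ_two, norm_eq_abs, sq_abs]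
    simp
    linear_combination (cos θ ^ 2 + sin θ ^ 2) * hφ + hθ'
  constructor
  · refine (mul_le_mul_of_nonneg_right (sqrt_three_div_two_mul_abs_le_abs_sin hθ)
      (le_max_of_le_left (abs_nonneg vu))).trans ?_
    rw [mul_max_of_nonneg _ _ (abs_nonneg _), ← abs_mul, ← abs_mul]
    refine max_le (abs_le_of_sq_le_sq ?_ (norm_nonneg _)) (abs_le_of_sq_le_sq ?_ (norm_nonneg _))
    · rw [hnorm]
      nlinarith [sq_nonneg (vu * cos θ + vs)]
    · have hswap : ‖vu • eu + vs • es‖ ^ 2 = (vs * cos θ + vu) ^ 2 + (vs * sin θ) ^ 2 := by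
        rw [hnorm]
        linear_combination (vu ^ 2 - vs ^ 2) * hθ'
      rw [hswap]
      nlinarith [sq_nonneg (vs * cos θ + vu)]
  · calc ‖vu • eu + vs • es‖ ≤ ‖vu • eu‖ + ‖vs • es‖ := norm_add_le _ _
      _ = |vu| + |vs| := by simp [norm_smul, heu_norm, hes_norm]
      _ ≤ 2 * max |vu| |vs| := by linarith [le_max_left |vu| |vs|, le_max_right |vu| |vs|]
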